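/- arXiv:2308.14354 — 8 statements merged into one kernel-verified Lean document; each statement's English description precedes it below -/
import Mathlib

section
/- Let b ≥ 2 be a natural number and let q be a prime number with q > b². Define S_{b,q} = { (b^{qp} mod qp)/(qp) : p prime } as a subset of the real interval [0,1]. Then the set of limit points (accumulation points) of S_{b,q} in ℝ is exactly { k/q : k = 0, 1, 2, …, q−1 }. -/
open Filter Topology

/-- For primes `p > b ^ q`, the residue of `b ^ (q * p)` modulo `q * p` is `b ^ q + p * k` with
`k < q`, and `k` is determined modulo `q` by `k * p = b ^ p - b`. -/
lemma exists_pow_mul_mod_eq {b q p : ℕ} (hq : q.Prime) (hp : p.Prime) (h : b ^ q < p) :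
    ∃ k < q, b ^ (q * p) % (q * p) = b ^ q + p * k ∧
      (k : ZMod q) * p = (b : ZMod q) ^ p - b := by
  have := Fact.mk hq
  have := Fact.mk hp
  set m := b ^ (q * p) % (q * p) with hm
  have hmod : m ≡ b ^ (q * p) [MOD q * p] := Nat.mod_modEq _ _
  have hmp : m % p = b ^ q := by
    have h1 : b ^ (q * p) ≡ b ^ q [MOD p] := by
      rw [← ZMod.natCast_eq_natCast_iff]
      push_cast
      rw [pow_mul, ZMod.pow_card]
    have h2 : m ≡ b ^ q [MOD p] := (hmod.of_mul_left q).trans h1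
    rw [h2, Nat.mod_eq_of_lt h]
  have hdiv : m = b ^ q + p * (m / p) := by
    rw [← hmp]
    exact (Nat.mod_add_div m p).symm
  refine ⟨m / p, ?_, hdiv, ?_⟩
  · exact Nat.div_lt_of_lt_mul (mul_comm q p ▸ Nat.mod_lt _ (Nat.mul_pos hq.pos hp.pos))
  · have h1 := (ZMod.natCast_eq_natCast_iff _ _ _).2 (hmod.of_mul_right p)
    rw [hdiv] at h1
    push_cast at h1
    rw [pow_mul, ZMod.pow_card] at h1
    linear_combination h1

lemma exists_prime_gt_modEq_and_cast_eq {q : ℕ} [Fact q.Prime] {r : ℕ}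
    (hr : r.Coprime (q - 1)) {c : ZMod q} (hc : c ≠ 0) (N : ℕ) :
    ∃ p > N, p.Prime ∧ p ≡ r [MOD q - 1] ∧ (p : ZMod q) = c := by
  have hq := Fact.out (p := q.Prime)
  have hcop : (q - 1).Coprime q := by
    obtain ⟨n, rfl⟩ := Nat.exists_eq_add_of_le' hq.one_le
    simp
  obtain ⟨a, har, hac⟩ := Nat.chineseRemainder hcop r c.val
  have haq : (a : ZMod q) = c := by
    rw [(ZMod.natCast_eq_natCast_iff _ _ _).2 hac, ZMod.natCast_zmod_val]
  have ha : a.Coprime ((q - 1) * q) := by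
    refine Nat.Coprime.mul_right ?_ ?_
    · rw [Nat.Coprime, har.gcd_eq]
      exact hr
    · rw [← ZMod.isUnit_iff_coprime, haq]
      exact hc.isUnit
  have h0 : (q - 1) * q ≠ 0 := by
    have := hq.two_le
    exact Nat.mul_ne_zero (by omega) hq.ne_zero
  obtain ⟨p, hpN, hp, hpa⟩ := Nat.forall_exists_prime_gt_and_modEq N h0 ha
  refine ⟨p, hpN, hp, (hpa.of_mul_right q).trans har, ?_⟩
  rw [← haq]
  exact (ZMod.natCast_eq_natCast_iff _ _ _).2 (hpa.of_mul_left (q - 1))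

lemma ZMod.pow_eq_pow_of_modEq_sub_one {q : ℕ} [Fact q.Prime] {x : ZMod q} (hx : x ≠ 0)
    {m n : ℕ} (h : m ≡ n [MOD q - 1]) : x ^ m = x ^ n :=
  pow_eq_pow_of_modEq h (ZMod.pow_card_sub_one_eq_one hx)

lemma exists_prime_gt_mul_eq_pow_sub {q : ℕ} [Fact q.Prime] {x : ZMod q} (hx : x ≠ 0)
    (hx2 : x ^ 2 ≠ 1) (k : ZMod q) (N : ℕ) :
    ∃ p > N, p.Prime ∧ (p : ZMod q) ≠ 0 ∧ k * p = x ^ p - x := by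
  have hq := Fact.out (p := q.Prime)
  by_cases hk : k = 0
  · obtain ⟨p, hpN, hp, hp1, hpc⟩ := exists_prime_gt_modEq_and_cast_eq
      (Nat.coprime_one_left (q - 1)) (one_ne_zero (α := ZMod q)) N
    refine ⟨p, hpN, hp, hpc ▸ one_ne_zero, ?_⟩
    rw [ZMod.pow_eq_pow_of_modEq_sub_one hx hp1, hk]
    ring
  · have hq2 : q ≠ 2 := by
      rintro rfl
      apply hx2
      rw [ZMod.pow_card]
      simpa using ZMod.pow_card_sub_one_eq_one hx
    have hq3 : 3 ≤ q := by
      have := hq.two_le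
      omega
    have hr : (q - 2).Coprime (q - 1) := by
      have h1 : q - 1 = q - 2 + 1 := by omega
      rw [h1]
      simp
    have hxr : x ^ (q - 2) = x⁻¹ := by
      apply eq_inv_of_mul_eq_one_left
      rw [← pow_succ, show q - 2 + 1 = q - 1 by omega, ZMod.pow_card_sub_one_eq_one hx]
    have hc : (x⁻¹ - x) / k ≠ 0 := by
      refine div_ne_zero (fun h => hx2 ?_) hk
      have h1 : x * x⁻¹ = 1 := mul_inv_cancel₀ hx
      linear_combination h1 - x * h
    obtain ⟨p, hpN, hp, hpr, hpc⟩ := exists_prime_gt_modEq_and_cast_eq hr hc N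
    refine ⟨p, hpN, hp, hpc ▸ hc, ?_⟩
    rw [ZMod.pow_eq_pow_of_modEq_sub_one hx hpr, hxr, hpc]
    field_simp

theorem stmt_0 (b q : ℕ) (hb : 2 ≤ b) (hq : q.Prime) (hgt : b ^ 2 < q) :
    {x : ℝ | AccPt x (𝓟 {r : ℝ | ∃ p : ℕ, p.Prime ∧
        r = ((b ^ (q * p) % (q * p) : ℕ) : ℝ) / ((q * p : ℕ) : ℝ)})} =
      {x : ℝ | ∃ k : ℕ, k < q ∧ x = (k : ℝ) / (q : ℝ)} := by
  have := Fact.mk hq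
  have hq0 : (0 : ℝ) < q := by exact_mod_cast hq.pos
  have hval {p k : ℕ} (hp : p.Prime) (h : b ^ (q * p) % (q * p) = b ^ q + p * k) :
      ((b ^ (q * p) % (q * p) : ℕ) : ℝ) / ((q * p : ℕ) : ℝ) =
        (k : ℝ) / q + (b : ℝ) ^ q / q / p := by
    have hp0 : (p : ℝ) ≠ 0 := by exact_mod_cast hp.ne_zero
    rw [h]
    push_cast
    field_simp
    ring
  have hlim : Tendsto (fun p : ℕ => (b : ℝ) ^ q / q / p) atTop (𝓝 0) :=
    tendsto_const_div_atTop_nhds_zero_nat _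
  ext x
  simp only [Set.mem_ofPred_eq]
  constructor
  · intro hx
    by_contra! hne
    have hev : ∀ᶠ p : ℕ in atTop, ∀ k ∈ Set.Iio q,
        |x - k / q| / 2 < |x - (k / q + (b : ℝ) ^ q / q / p)| := by
      rw [eventually_all_finite (Set.finite_Iio q)]
      intro k hk
      have hpos : 0 < |x - k / q| := abs_pos.2 (sub_ne_zero.2 (hne k hk))
      have ht : Tendsto (fun p : ℕ => |x - (k / q + (b : ℝ) ^ q / q / p)|) atTop
          (𝓝 |x - (k / q + 0)|) := ((hlim.const_add _).const_sub x).abs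
      exact ht.eventually_const_lt (by rw [add_zero]; linarith)
    obtain ⟨N, hN⟩ := eventually_atTop.1 (hev.and (eventually_gt_atTop (b ^ q)))
    have hU : ∀ᶠ y in 𝓝 x, ∀ k ∈ Set.Iio q, |x - y| < |x - k / q| / 2 := by
      rw [eventually_all_finite (Set.finite_Iio q)]
      intro k hk
      have hpos : 0 < |x - k / q| := abs_pos.2 (sub_ne_zero.2 (hne k hk))
      have ht : Tendsto (fun y : ℝ => |x - y|) (𝓝 x) (𝓝 |x - x|) :=
        (tendsto_id.const_sub x).abs
      exact ht.eventually_lt_const (by rw [sub_self, abs_zero]; linarith)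
    set f : ℕ → ℝ := fun p => ((b ^ (q * p) % (q * p) : ℕ) : ℝ) / ((q * p : ℕ) : ℝ)
    have hF : ∀ᶠ y in 𝓝 x, y ∈ (f '' Set.Iio N \ {x})ᶜ :=
      (((Set.finite_Iio N).image f).sdiff.isClosed.isOpen_compl).mem_nhds (by simp)
    obtain ⟨y, ⟨hyx, p, hp, hy⟩, hyU, hyF⟩ :=
      ((accPt_iff_frequently.1 hx).and_eventually (hU.and hF)).exists
    rcases lt_or_ge p N with hpN | hpN
    · exact hyF ⟨⟨p, hpN, hy.symm⟩, hyx⟩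
    · obtain ⟨h1, h2⟩ := hN p hpN
      obtain ⟨k, hk, hm, -⟩ := exists_pow_mul_mod_eq hq hp h2
      rw [hval hp hm] at hy
      exact lt_asymm (h1 k hk) (hy ▸ hyU k hk)
  · rintro ⟨k, hk, rfl⟩
    have hbq : (b : ZMod q) ≠ 0 := by
      rw [Ne, ZMod.natCast_eq_zero_iff]
      exact Nat.not_dvd_of_pos_of_lt (by omega) (by nlinarith)
    have hb2 : (b : ZMod q) ^ 2 ≠ 1 := by
      intro h
      have h1 : ((b ^ 2 : ℕ) : ZMod q) = ((1 : ℕ) : ZMod q) := by exact_mod_cast h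
      rw [ZMod.natCast_eq_natCast_iff] at h1
      have := h1.eq_of_lt_of_lt hgt hq.one_lt
      nlinarith
    rw [accPt_iff_nhds]
    intro U hU
    have ht : Tendsto (fun p : ℕ => (k : ℝ) / q + (b : ℝ) ^ q / q / p) atTop
        (𝓝 ((k : ℝ) / q)) := by simpa using hlim.const_add ((k : ℝ) / q)
    obtain ⟨N, hN⟩ := eventually_atTop.1 ((ht.eventually_mem hU).and (eventually_gt_atTop (b ^ q)))
    obtain ⟨p, hpN, hp, hp0, hkp⟩ := exists_prime_gt_mul_eq_pow_sub hbq hb2 (k : ZMod q) N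
    obtain ⟨h1, h2⟩ := hN p hpN.le
    obtain ⟨j, hj, hm, hjp⟩ := exists_pow_mul_mod_eq hq hp h2
    have hjk : j = k := by
      have h3 : (j : ZMod q) = k := mul_right_cancel₀ hp0 (hjp.trans hkp.symm)
      exact ((ZMod.natCast_eq_natCast_iff _ _ _).1 h3).eq_of_lt_of_lt hj hk
    subst hjk
    refine ⟨_, ⟨h1, p, hp, (hval hp hm).symm⟩, ?_⟩
    have hp1 : (0 : ℝ) < p := by exact_mod_cast hp.pos
    have hb0 : (0 : ℝ) < b := by exact_mod_cast (by omega : 0 < b)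
    have : 0 < (b : ℝ) ^ q / q / p := by positivity
    linarith
end

section
/- Let b ≥ 2 be a natural number. The set S_b = { (b^n mod n)/n : n ∈ ℕ, n ≥ 1 } is dense in the real interval [0,1]. -/
theorem exists_prime_gt_modEq_modEq {q r : ℕ} (hq : 2 ≤ q) (hr : r.Coprime q) (N : ℕ) :
    ∃ p > N, p.Prime ∧ p ≡ r [MOD q] ∧ q - 1 ∣ p + 1 := by
  obtain ⟨k, rfl⟩ : ∃ k, q = k + 2 := ⟨q - 2, by omega⟩
  have hco : (k + 2).Coprime (k + 1) := by
    rw [Nat.coprime_comm]; exact Nat.coprime_self_add_right.2 (Nat.coprime_one_right _)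
  obtain ⟨u, hu1, hu2⟩ := Nat.chineseRemainder hco r k
  have hk : k.Coprime (k + 1) := by simp
  have hu : u.Coprime ((k + 2) * (k + 1)) := by
    refine Nat.Coprime.mul_right ?_ ?_
    · exact (Nat.ModEq.gcd_eq hu1).trans hr
    · exact (Nat.ModEq.gcd_eq hu2).trans hk
  obtain ⟨p, hpN, hp, hpu⟩ :=
    Nat.forall_exists_prime_gt_and_modEq N (by positivity : (k + 2) * (k + 1) ≠ 0) hu
  refine ⟨p, hpN, hp, (hpu.of_mul_right _).trans hu1, ?_⟩
  have h : p + 1 ≡ k + 1 [MOD k + 1] := ((hpu.of_mul_left _).trans hu2).add_right 1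
  exact (Nat.modEq_zero_iff_dvd).1 (h.trans (by simp [Nat.ModEq]))

theorem exists_prime_pow_mul_mod_eq {b q t : ℕ} (hb : 2 ≤ b) (hq : q.Prime) (hbq : b ^ 2 < q)
    (ht0 : 0 < t) (htq : t < q) :
    ∃ p, b ^ q < p ∧ b ^ (p * q) % (p * q) = b ^ q + p * t := by
  have : Fact q.Prime := ⟨hq⟩
  have hb0 : (b : ZMod q) ≠ 0 := by
    rw [Ne, ZMod.natCast_eq_zero_iff]
    exact fun h => absurd (Nat.le_of_dvd (by omega) h) (by nlinarith)
  have ht : (t : ZMod q) ≠ 0 := by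
    rw [Ne, ZMod.natCast_eq_zero_iff]
    exact fun h => absurd (Nat.le_of_dvd ht0 h) (by omega)
  have hb2 : (1 - b ^ 2 : ZMod q) ≠ 0 := by
    intro h
    have h1 : ((1 : ℕ) : ZMod q) = ((b ^ 2 : ℕ) : ZMod q) := by
      push_cast; exact sub_eq_zero.1 h
    rw [ZMod.natCast_eq_natCast_iff', Nat.mod_eq_of_lt hq.one_lt, Nat.mod_eq_of_lt hbq] at h1
    nlinarith
  obtain ⟨r, hr⟩ := ZMod.natCast_zmod_surjective ((1 - (b : ZMod q) ^ 2) / ((b : ZMod q) * (t : ZMod q)))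
  have hr0 : (r : ZMod q) ≠ 0 := hr ▸ div_ne_zero hb2 (mul_ne_zero hb0 ht)
  have hrq : r.Coprime q := by
    rw [Nat.coprime_comm, hq.coprime_iff_not_dvd, ← ZMod.natCast_eq_zero_iff]
    exact hr0
  obtain ⟨p, hpN, hp, hpr, hdvd⟩ := exists_prime_gt_modEq_modEq hq.two_le hrq (max (b ^ q) q)
  obtain ⟨hpb, hpq⟩ := max_lt_iff.1 hpN
  refine ⟨p, hpb, ?_⟩
  have : Fact p.Prime := ⟨hp⟩
  have hlt : b ^ q + p * t < p * q := by nlinarith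
  rw [← Nat.mod_eq_of_lt hlt]
  refine (Nat.modEq_and_modEq_iff_modEq_mul ?_).1 ⟨?_, ?_⟩
  · exact (Nat.coprime_primes hp hq).2 hpq.ne'
  · rw [← ZMod.natCast_eq_natCast_iff]
    push_cast
    rw [mul_comm p q, pow_mul, ZMod.pow_card]
    simp
  · rw [← ZMod.natCast_eq_natCast_iff]
    have hpr' : (p : ZMod q) = r := (ZMod.natCast_eq_natCast_iff _ _ _).2 hpr
    push_cast
    rw [pow_mul, ZMod.pow_card, ZMod.pow_card, hpr', hr]
    obtain ⟨c, hc⟩ := hdvd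
    have h1 : (b : ZMod q) ^ (p + 1) = 1 := by
      rw [hc, pow_mul, ZMod.pow_card_sub_one_eq_one hb0, one_pow]
    apply mul_right_cancel₀ hb0
    rw [← pow_succ, h1]
    field_simp
    ring

theorem stmt_1 (b : ℕ) (hb : 2 ≤ b) :
    Set.Icc (0 : ℝ) 1 ⊆
      closure {r : ℝ | ∃ n : ℕ, 1 ≤ n ∧ r = ((b ^ n % n : ℕ) : ℝ) / (n : ℝ)} := by
  rintro x ⟨hx0, hx1⟩
  rw [Metric.mem_closure_iff]
  intro ε hε
  obtain ⟨M, hM⟩ := exists_nat_gt (3 / ε)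
  obtain ⟨q, hqM, hq⟩ := Nat.exists_infinite_primes (max M (b ^ 2 + 1))
  have hbq : b ^ 2 < q := (le_max_right _ _).trans hqM
  have hq0 : (0 : ℝ) < q := by exact_mod_cast hq.pos
  have hq2 : (2 : ℝ) < q := by exact_mod_cast (by nlinarith : 2 < q)
  have hqε : 3 < ε * q := by
    have hMq : (M : ℝ) ≤ q := by exact_mod_cast (le_max_left _ _).trans hqM
    rw [mul_comm]
    exact (div_lt_iff₀ hε).1 (hM.trans_le hMq)
  have hy0 : 0 ≤ x * (q - 2) := mul_nonneg hx0 (by linarith)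
  have hfl := Nat.floor_le hy0
  have hfl' := Nat.lt_floor_add_one (x * ((q : ℝ) - 2))
  set m := ⌊x * ((q : ℝ) - 2)⌋₊
  have hmq : m + 1 < q := by
    have : (m : ℝ) + 1 < q := by nlinarith
    exact_mod_cast this
  obtain ⟨p, hpb, hp⟩ := exists_prime_pow_mul_mod_eq hb hq hbq m.succ_pos hmq
  have hp0 : 0 < p := by omega
  refine ⟨_, ⟨p * q, Nat.mul_pos hp0 hq.pos, rfl⟩, ?_⟩
  rw [hp]
  have hpR : (0 : ℝ) < p := by exact_mod_cast hp0
  have hd1 : ((b : ℝ) ^ q) / p < 1 := by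
    rw [div_lt_one hpR]; exact_mod_cast hpb
  have hd0 : 0 ≤ ((b : ℝ) ^ q) / p := by positivity
  have key : x - ((b ^ q + p * m.succ : ℕ) : ℝ) / ((p * q : ℕ) : ℝ)
      = (x * q - (m + 1) - (b : ℝ) ^ q / p) / q := by
    push_cast
    field_simp
    ring
  rw [Real.dist_eq, key, abs_div, abs_of_pos hq0, div_lt_iff₀ hq0]
  refine lt_of_le_of_lt ?_ hqε
  rw [abs_le]
  constructor <;> linarith
end

section
/- Let b ≥ 2 be a natural number and let q be a prime with q > b². Then for every k with 0 ≤ k ≤ q−1, the set Z_k is nonempty, i.e. there exists a natural number x with 0 ≤ x < q(q−1), gcd(x, q(q−1)) = 1, and b^x ≡ kx + b (mod q). -/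
theorem stmt_4 (b q : ℕ) (hb : 2 ≤ b) (hq : q.Prime) (hgt : b ^ 2 < q) :
    ∀ k : ℕ, k ≤ q - 1 →
      ∃ x : ℕ, x < q * (q - 1) ∧ Nat.gcd x (q * (q - 1)) = 1 ∧
        b ^ x ≡ k * x + b [MOD q] := by
  intro k hk
  have : Fact q.Prime := ⟨hq⟩
  have hq5 : 4 < q := by nlinarith
  obtain rfl | hkpos := Nat.eq_zero_or_pos k
  · refine ⟨1, by nlinarith [Nat.sub_add_cancel hq.one_le], by simp, ?_⟩
    simp [Nat.ModEq]
  have hk0 : (k : ZMod q) ≠ 0 := by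
    rw [Ne, ZMod.natCast_eq_zero_iff]
    exact Nat.not_dvd_of_pos_of_lt hkpos (by omega)
  have hb0 : (b : ZMod q) ≠ 0 := by
    rw [Ne, ZMod.natCast_eq_zero_iff]
    exact Nat.not_dvd_of_pos_of_lt (by omega) (by nlinarith)
  have hfermat : (b : ZMod q) ^ (q - 1) = 1 := ZMod.pow_card_sub_one_eq_one hb0
  have hsq : (b : ZMod q) ^ 2 ≠ 1 := by
    intro h
    have h' : b ^ 2 ≡ 1 [MOD q] := by
      rw [← ZMod.natCast_eq_natCast_iff]
      exact_mod_cast h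
    have := Nat.ModEq.eq_of_lt_of_lt h' hgt (by omega)
    nlinarith
  -- The exponent `q - 2` represents `-1` modulo `q - 1`.
  have hdiff : (b : ZMod q) ^ (q - 2) - b ≠ 0 := by
    intro h
    apply hsq
    rw [← hfermat, show q - 1 = (q - 2) + 1 by omega, pow_succ _ (q - 2), sub_eq_zero.mp h, sq]
  set y : ZMod q := ((b : ZMod q) ^ (q - 2) - b) / k with hy
  have hy0 : y ≠ 0 := div_ne_zero hdiff hk0
  have hcop : Nat.Coprime q (q - 1) :=
    (Nat.coprime_self_sub_right hq.one_le).mpr (Nat.coprime_one_right q)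
  obtain ⟨x, hxq, hxq1⟩ := Nat.chineseRemainder hcop y.val (q - 2)
  have hxy : (x : ZMod q) = y := by
    rw [← ZMod.natCast_zmod_val y]
    exact (ZMod.natCast_eq_natCast_iff _ _ _).mpr hxq
  have hr : (x % (q * (q - 1))) ≡ x [MOD q * (q - 1)] := Nat.mod_modEq _ _
  refine ⟨x % (q * (q - 1)), Nat.mod_lt _ (Nat.mul_pos hq.pos (by omega)), ?_, ?_⟩
  · rw [hr.gcd_eq]
    refine Nat.Coprime.mul_right ?_ ?_
    · rw [Nat.coprime_comm, hq.coprime_iff_not_dvd, ← ZMod.natCast_eq_zero_iff, hxy]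
      exact hy0
    · rw [Nat.Coprime, hxq1.gcd_eq, show q - 1 = (q - 2) + 1 by omega]
      simp
  · have hzq : ((x % (q * (q - 1)) : ℕ) : ZMod q) = y := by
      rw [← hxy]
      exact (ZMod.natCast_eq_natCast_iff _ _ _).mpr (hr.of_mul_right _)
    have hzq1 : x % (q * (q - 1)) ≡ q - 2 [MOD q - 1] := (hr.of_mul_left _).trans hxq1
    rw [← ZMod.natCast_eq_natCast_iff]
    simp only [Nat.cast_add, Nat.cast_mul, Nat.cast_pow]
    rw [hzq, hy, mul_div_cancel₀ _ hk0, sub_add_cancel, pow_eq_pow_mod _ hfermat, hzq1,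
      ← pow_eq_pow_mod _ hfermat]
end

section
/- Let b ≥ 2 be a natural number, let q be a prime with q ∤ b, and let k be a natural number with 0 ≤ k ≤ q−1. Suppose x is a natural number with gcd(x, q(q−1)) = 1 and b^x ≡ kx + b (mod q). Then for every prime p with p ≡ x (mod q(q−1)) and b^q + kp < qp, one has (b^{qp} mod qp) = b^q + kp, and consequently (b^{qp} mod qp)/(qp) = b^q/(qp) + k/q as real numbers. -/
theorem Nat.Prime.pow_self_modEq {p : ℕ} (hp : p.Prime) (a : ℕ) : a ^ p ≡ a [MOD p] := by
  have := Fact.mk hp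
  rw [← ZMod.natCast_eq_natCast_iff]
  push_cast
  exact ZMod.pow_card _

theorem Nat.Prime.pow_modEq_pow_of_modEq {q b m n : ℕ} (hq : q.Prime) (hnd : ¬ q ∣ b)
    (h : m ≡ n [MOD q - 1]) : b ^ m ≡ b ^ n [MOD q] := by
  have := Fact.mk hq
  have hb : (b : ZMod q) ≠ 0 := by rwa [Ne, ZMod.natCast_eq_zero_iff]
  have h1 := ZMod.pow_card_sub_one_eq_one hb
  rw [← ZMod.natCast_eq_natCast_iff]
  push_cast
  rw [pow_eq_pow_mod m h1, pow_eq_pow_mod n h1, h]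

theorem stmt_8 (b q k x : ℕ) (hb : 2 ≤ b) (hq : q.Prime) (hnd : ¬ q ∣ b)
    (hk : k ≤ q - 1) (hx : Nat.gcd x (q * (q - 1)) = 1)
    (hsol : b ^ x ≡ k * x + b [MOD q]) :
    ∀ p : ℕ, p.Prime → p ≡ x [MOD q * (q - 1)] → b ^ q + k * p < q * p →
      b ^ (q * p) % (q * p) = b ^ q + k * p ∧
        ((b ^ (q * p) % (q * p) : ℕ) : ℝ) / ((q * p : ℕ) : ℝ) =
          ((b : ℝ) ^ q) / ((q : ℝ) * (p : ℝ)) + (k : ℝ) / (q : ℝ) := by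
  intro p hp hpx hlt
  have hcop : Nat.Coprime q p := by
    have h : Nat.gcd p (q * (q - 1)) = 1 := by rw [hpx.gcd_eq, hx]
    exact (Nat.Coprime.coprime_mul_right_right h).symm
  have hmodp : b ^ (q * p) ≡ b ^ q + k * p [MOD p] := by
    rw [pow_mul]
    exact (hp.pow_self_modEq _).trans (by simp [Nat.ModEq])
  have hmodq : b ^ (q * p) ≡ b ^ q + k * p [MOD q] := by
    have hpxq : x ≡ p [MOD q] := (hpx.of_mul_right _).symm
    calc b ^ (q * p) ≡ b ^ p [MOD q] := by
          rw [pow_mul]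
          exact (hq.pow_self_modEq b).pow p
      _ ≡ b ^ x [MOD q] := hq.pow_modEq_pow_of_modEq hnd (hpx.of_mul_left _)
      _ ≡ k * x + b [MOD q] := hsol
      _ ≡ k * p + b ^ q [MOD q] := (hpxq.mul_left k).add (hq.pow_self_modEq b).symm
      _ = b ^ q + k * p := add_comm _ _
  have hmod : b ^ (q * p) % (q * p) = b ^ q + k * p :=
    Nat.mod_eq_of_modEq ((Nat.modEq_and_modEq_iff_modEq_mul hcop).1 ⟨hmodq, hmodp⟩) hlt
  refine ⟨hmod, ?_⟩
  have hq0 : (q : ℝ) ≠ 0 := by exact_mod_cast hq.ne_zero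
  have hp0 : (p : ℝ) ≠ 0 := by exact_mod_cast hp.ne_zero
  rw [hmod]
  push_cast
  field_simp
end

section
/- Let b ≥ 2 be a natural number and let q be a prime with q ∤ b. Let δ denote the multiplicative order of b modulo q, and let 𝒩 = { α ∈ ℕ : 0 ≤ α < q−1, gcd(α, q−1) = 1, α ≡ 1 (mod δ) }. Then Z_0 = { (αq + β(q−1)) mod q(q−1) : α ∈ 𝒩, β ∈ ℕ, 0 ≤ β < q, gcd(β, q) = 1 }. -/
/-- The solution set `Z_k` from the paper. -/
def Zset (b q k : ℕ) : Set ℕ :=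
  {x : ℕ | x < q * (q - 1) ∧ Nat.gcd x (q * (q - 1)) = 1 ∧ b ^ x ≡ k * x + b [MOD q]}

theorem orderOf_unitOfCoprime_eq_of_isLeast {b q δ : ℕ} (h : b.Coprime q)
    (hδ : IsLeast {e : ℕ | 0 < e ∧ b ^ e ≡ 1 [MOD q]} δ) :
    orderOf (ZMod.unitOfCoprime b h) = δ := by
  have key (e : ℕ) : ZMod.unitOfCoprime b h ^ e = 1 ↔ b ^ e ≡ 1 [MOD q] := by
    rw [← ZMod.natCast_eq_natCast_iff, Units.ext_iff]
    simp
  rw [orderOf_eq_iff hδ.1.1]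
  refine ⟨(key δ).2 hδ.1.2, fun m hm hm0 h1 => ?_⟩
  exact absurd (hδ.2 ⟨hm0, (key m).1 h1⟩) (not_le.2 hm)

theorem pow_modEq_self_iff_of_isLeast {b q δ : ℕ} (h : b.Coprime q)
    (hδ : IsLeast {e : ℕ | 0 < e ∧ b ^ e ≡ 1 [MOD q]} δ) (x : ℕ) :
    b ^ x ≡ b [MOD q] ↔ x ≡ 1 [MOD δ] := by
  rw [← orderOf_unitOfCoprime_eq_of_isLeast h hδ, ← pow_eq_pow_iff_modEq,
    ← ZMod.natCast_eq_natCast_iff, Units.ext_iff]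
  simp

theorem dvd_sub_one_of_isLeast {b q δ : ℕ} (hq : q.Prime) (h : b.Coprime q)
    (hδ : IsLeast {e : ℕ | 0 < e ∧ b ^ e ≡ 1 [MOD q]} δ) : δ ∣ q - 1 := by
  rw [← orderOf_unitOfCoprime_eq_of_isLeast h hδ, ← Nat.totient_prime hq]
  exact orderOf_dvd_of_pow_eq_one (ZMod.pow_totient _)

theorem mul_succ_add_mul_modEq (α β m : ℕ) : α * (m + 1) + β * m ≡ α [MOD m] := by
  have h : α * (m + 1) + β * m = α + (α + β) * m := by ring
  simp [h, Nat.ModEq]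

theorem coprime_mul_succ_add_mul_iff (α β m : ℕ) :
    (α * (m + 1) + β * m).Coprime ((m + 1) * m) ↔ α.Coprime m ∧ β.Coprime (m + 1) := by
  have h₁ : (α * (m + 1) + β * m).gcd m = α.gcd m := (mul_succ_add_mul_modEq α β m).gcd_eq
  have h₂ : (α * (m + 1) + β * m).Coprime (m + 1) ↔ β.Coprime (m + 1) := by
    simp [Nat.coprime_mul_iff_left]
  rw [Nat.coprime_mul_iff_right, h₂, and_comm, Nat.Coprime, h₁]

theorem exists_modEq_mul_succ_add_mul {x m : ℕ} (hx : x.Coprime (m + 1)) (hm : 0 < m) :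
    ∃ β < m + 1, x ≡ x % m * (m + 1) + β * m [MOD (m + 1) * m] := by
  have hr : x % (m + 1) ≠ 0 := fun h => by
    have := Nat.eq_one_of_dvd_coprimes hx (Nat.dvd_of_mod_eq_zero h) dvd_rfl
    omega
  have hlt : x % (m + 1) < m + 1 := Nat.mod_lt _ m.succ_pos
  refine ⟨m + 1 - x % (m + 1), by omega, ?_⟩
  rw [← Nat.modEq_and_modEq_iff_modEq_mul (by simp)]
  refine ⟨?_, (Nat.mod_modEq x m).symm.trans (mul_succ_add_mul_modEq _ _ m).symm⟩
  rw [← ZMod.natCast_eq_natCast_iff]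
  push_cast [Nat.cast_sub hlt.le]
  have h0 : (m : ZMod (m + 1)) + 1 = 0 := by exact_mod_cast ZMod.natCast_self (m + 1)
  have hm1 : (m : ZMod (m + 1)) = -1 := eq_neg_of_add_eq_zero_left h0
  have hc : ((x % (m + 1) : ℕ) : ZMod (m + 1)) = x := ZMod.natCast_mod x (m + 1)
  rw [hc, h0, hm1]
  ring

theorem stmt_9 (b q δ : ℕ) (hb : 2 ≤ b) (hq : q.Prime) (hnd : ¬ q ∣ b)
    (hδ : IsLeast {e : ℕ | 0 < e ∧ b ^ e ≡ 1 [MOD q]} δ) :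
    Zset b q 0 =
      {x : ℕ | ∃ α β : ℕ, α < q - 1 ∧ Nat.gcd α (q - 1) = 1 ∧ α ≡ 1 [MOD δ] ∧
        β < q ∧ Nat.gcd β q = 1 ∧ x = (α * q + β * (q - 1)) % (q * (q - 1))} := by
  have hbq : b.Coprime q := ((Nat.Prime.coprime_iff_not_dvd hq).2 hnd).symm
  have hδq := dvd_sub_one_of_isLeast hq hbq hδ
  obtain ⟨m, rfl⟩ : ∃ m, q = m + 1 := ⟨q - 1, (Nat.sub_add_cancel hq.one_le).symm⟩
  have hm : 0 < m := Nat.lt_of_succ_lt_succ hq.one_lt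
  rw [Nat.add_sub_cancel] at hδq
  ext x
  simp only [Zset, Set.mem_ofPred_eq, zero_mul, zero_add, Nat.add_sub_cancel,
    pow_modEq_self_iff_of_isLeast hbq hδ]
  constructor
  · rintro ⟨hx, hgcd, hmod⟩
    obtain ⟨β, hβ, h⟩ := exists_modEq_mul_succ_add_mul (Nat.Coprime.coprime_mul_right_right hgcd) hm
    obtain ⟨hα, hβ'⟩ := (coprime_mul_succ_add_mul_iff _ _ _).1 (h.gcd_eq.symm.trans hgcd)
    exact ⟨x % m, β, Nat.mod_lt _ hm, hα, ((Nat.mod_modEq x m).of_dvd hδq).trans hmod, hβ, hβ',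
      (Nat.mod_eq_of_lt hx).symm.trans h⟩
  · rintro ⟨α, β, -, hα, hmod, -, hβ, rfl⟩
    have h := Nat.mod_modEq (α * (m + 1) + β * m) ((m + 1) * m)
    refine ⟨Nat.mod_lt _ (by positivity), ?_, ?_⟩
    · exact h.gcd_eq.trans ((coprime_mul_succ_add_mul_iff _ _ _).2 ⟨hα, hβ⟩)
    · exact (((h.of_dvd (dvd_mul_left _ _)).trans
        (mul_succ_add_mul_modEq α β m)).of_dvd hδq).trans hmod
end

section
/- Let b ≥ 2 be a natural number and let q be a prime with q ∤ b and b² ≡ 1 (mod q). Define S_{b,q} = { (b^{qp} mod qp)/(qp) : p prime } as a subset of ℝ. Then the set of limit points of S_{b,q} in ℝ is exactly {0}. -/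
open Filter Topology

theorem pow_prime_modEq_self (b : ℕ) {p : ℕ} (hp : p.Prime) : b ^ p ≡ b [MOD p] := by
  have := Fact.mk hp
  rw [← ZMod.natCast_eq_natCast_iff]
  push_cast
  exact ZMod.pow_card _

theorem pow_odd_modEq_self {b q : ℕ} (hb2 : b ^ 2 ≡ 1 [MOD q]) {n : ℕ} (hn : Odd n) :
    b ^ n ≡ b [MOD q] := by
  obtain ⟨k, rfl⟩ := hn
  simpa [pow_add, pow_mul] using (hb2.pow k).mul_right b

theorem pow_mul_prime_modEq {b q p : ℕ} (hq : q.Prime) (hb2 : b ^ 2 ≡ 1 [MOD q])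
    (hp : p.Prime) (hp2 : p ≠ 2) (hpq : p ≠ q) :
    b ^ (q * p) ≡ b ^ q [MOD (q * p)] := by
  rw [← Nat.modEq_and_modEq_iff_modEq_mul ((Nat.coprime_primes hq hp).2 hpq.symm)]
  constructor
  · rw [mul_comm, pow_mul]
    exact (pow_odd_modEq_self hb2 (hp.odd_of_ne_two hp2)).pow q
  · rw [pow_mul]
    exact pow_prime_modEq_self _ hp

theorem pow_mul_prime_mod_eq {b q p : ℕ} (hq : q.Prime) (hb2 : b ^ 2 ≡ 1 [MOD q])
    (hp : p.Prime) (hlarge : b ^ q + q + 2 < p) :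
    b ^ (q * p) % (q * p) = b ^ q := by
  rw [pow_mul_prime_modEq hq hb2 hp (by omega) (by omega)]
  apply Nat.mod_eq_of_lt
  nlinarith [hq.one_lt]

theorem stmt_12 (b q : ℕ) (hb : 2 ≤ b) (hq : q.Prime) (hnd : ¬ q ∣ b)
    (hb2 : b ^ 2 ≡ 1 [MOD q]) :
    {x : ℝ | AccPt x (𝓟 {r : ℝ | ∃ p : ℕ, p.Prime ∧
        r = ((b ^ (q * p) % (q * p) : ℕ) : ℝ) / ((q * p : ℕ) : ℝ)})} = {(0 : ℝ)} := by
  set f : ℕ → ℝ := fun p ↦ ((b ^ (q * p) % (q * p) : ℕ) : ℝ) / ((q * p : ℕ) : ℝ) with hf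
  have hfp : ∀ p : ℕ, p.Prime → b ^ q + q + 2 < p →
      f p = ((b ^ q : ℕ) : ℝ) / ((q * p : ℕ) : ℝ) := fun p hp hlarge ↦ by
    simp only [hf, pow_mul_prime_mod_eq hq hb2 hp hlarge]
  have hlim : Tendsto (fun p : ℕ ↦ ((b ^ q : ℕ) : ℝ) / ((q * p : ℕ) : ℝ)) atTop (𝓝 0) :=
    (tendsto_natCast_atTop_atTop.comp
      (tendsto_id.const_mul_atTop' hq.pos)).const_div_atTop _
  ext x
  simp only [Set.mem_ofPred_eq, Set.mem_singleton_iff]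
  constructor
  · intro hx
    by_contra hx0
    obtain ⟨U, hU, V, hV, hUV⟩ := Filter.disjoint_iff.1 (disjoint_nhds_nhds.2 hx0)
    obtain ⟨N, hN⟩ := eventually_atTop.1 (hlim.eventually hV)
    refine Set.Infinite.of_accPt (hx.nhds_inter hU)
      (((Finset.range (N + (b ^ q + q + 3))).finite_toSet.image f).subset ?_)
    rintro r ⟨hrU, p, hp, rfl⟩
    refine ⟨p, ?_, rfl⟩
    by_contra hpN
    rw [Finset.mem_coe, Finset.mem_range] at hpN
    have hrV : f p ∈ V := by
      rw [hfp p hp (by omega)]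
      exact hN p (by omega)
    exact Set.disjoint_left.1 hUV hrU hrV
  · rintro rfl
    rw [accPt_iff_nhds]
    intro U hU
    obtain ⟨N, hN⟩ := eventually_atTop.1 (hlim.eventually hU)
    obtain ⟨p, hpN, hp⟩ := Nat.exists_infinite_primes (N + (b ^ q + q + 3))
    have hval := hfp p hp (by omega)
    refine ⟨f p, ⟨?_, p, hp, rfl⟩, ?_⟩
    · rw [hval]
      exact hN p (by omega)
    · rw [hval]
      have := hq.pos
      have := hp.pos
      positivity
end

section
/- Let b ≥ 2 be a natural number and let q be a prime with q ∤ b. Let δ denote the multiplicative order of b modulo q and let m_b(q) be the cardinality of 𝒩 = { α ∈ ℕ : 0 ≤ α < q−1, gcd(α, q−1) = 1, α ≡ 1 (mod δ) }. Then the cardinality of Z_0 equals (q−1)·m_b(q). -/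
/-- For `b` invertible modulo the prime `q`, `b ^ x ≡ b` iff `x ≡ 1` modulo the order of `b`. -/
theorem Nat.pow_modEq_self_iff_modEq_one {b q δ : ℕ} (hq : q.Prime) (hnd : ¬ q ∣ b)
    (hδ : IsLeast {e : ℕ | 0 < e ∧ b ^ e ≡ 1 [MOD q]} δ) (x : ℕ) :
    b ^ x ≡ b [MOD q] ↔ x ≡ 1 [MOD δ] := by
  have hcop : Nat.Coprime b q := ((Nat.Prime.coprime_iff_not_dvd hq).2 hnd).symm
  set u := ZMod.unitOfCoprime b hcop with hu
  have key (m n : ℕ) : b ^ m ≡ b ^ n [MOD q] ↔ u ^ m = u ^ n := by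
    rw [← ZMod.natCast_eq_natCast_iff, Units.ext_iff]
    simp [hu]
  have hord : orderOf u = δ := by
    have hone (m : ℕ) : b ^ m ≡ 1 [MOD q] ↔ u ^ m = 1 := by simpa using key m 0
    have : Fact q.Prime := ⟨hq⟩
    apply le_antisymm
    · exact orderOf_le_of_pow_eq_one hδ.1.1 ((hone δ).1 hδ.1.2)
    · exact hδ.2 ⟨orderOf_pos u, (hone _).2 (pow_orderOf_eq_one u)⟩
  rw [← hord, ← pow_eq_pow_iff_modEq, ← key, pow_one]

/-- The order of `b` modulo the prime `q` divides `q - 1`. -/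
theorem Nat.order_dvd_prime_sub_one {b q δ : ℕ} (hq : q.Prime) (hnd : ¬ q ∣ b)
    (hδ : IsLeast {e : ℕ | 0 < e ∧ b ^ e ≡ 1 [MOD q]} δ) : δ ∣ q - 1 := by
  have hcop : Nat.Coprime b q := ((Nat.Prime.coprime_iff_not_dvd hq).2 hnd).symm
  have h1 : b ^ (q - 1 + 1) ≡ b [MOD q] := by
    have h := (Nat.ModEq.pow_totient hcop).mul_right b
    rwa [Nat.totient_prime hq, one_mul, ← pow_succ] at h
  have h2 := (Nat.pow_modEq_self_iff_modEq_one hq hnd hδ _).1 h1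
  simpa using (Nat.modEq_iff_dvd' (Nat.le_add_left 1 (q - 1))).1 h2.symm

/-- Residues modulo `q` and `q - 1` identify `Zset b q 0` with a product. -/
theorem Zset_zero_bijOn {b q δ : ℕ} (hq : q.Prime) (hnd : ¬ q ∣ b)
    (hδ : IsLeast {e : ℕ | 0 < e ∧ b ^ e ≡ 1 [MOD q]} δ) :
    Set.BijOn (fun x => (x % q, x % (q - 1))) (Zset b q 0)
      (Set.Ioo 0 q ×ˢ {α : ℕ | α < q - 1 ∧ Nat.gcd α (q - 1) = 1 ∧ α ≡ 1 [MOD δ]}) := by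
  have hq0 : 0 < q := hq.pos
  have hq1 : 0 < q - 1 := Nat.sub_pos_of_lt hq.one_lt
  have hcop : Nat.Coprime q (q - 1) := (Nat.coprime_self_sub_right hq0).2 (by simp)
  have hdvd := Nat.order_dvd_prime_sub_one hq hnd hδ
  have hmem (x : ℕ) : x ∈ Zset b q 0 ↔
      x < q * (q - 1) ∧ (Nat.Coprime x q ∧ Nat.Coprime x (q - 1)) ∧ x ≡ 1 [MOD δ] := by
    rw [← Nat.coprime_mul_iff_right, ← Nat.pow_modEq_self_iff_modEq_one hq hnd hδ]
    simp [Zset, Nat.Coprime]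
  refine ⟨fun x hx => ?_, fun x hx y hy hxy => ?_, fun ⟨r, α⟩ ⟨hr, hα⟩ => ?_⟩
  · obtain ⟨-, ⟨hxq, hxq1⟩, hx1⟩ := (hmem x).1 hx
    refine ⟨⟨Nat.pos_of_ne_zero fun h => ?_, Nat.mod_lt _ hq0⟩, Nat.mod_lt _ hq1, ?_, ?_⟩
    · exact (Nat.Prime.coprime_iff_not_dvd hq).1 hxq.symm (Nat.dvd_of_mod_eq_zero h)
    · exact (Nat.mod_modEq x (q - 1)).gcd_eq.trans hxq1
    · exact ((Nat.mod_modEq x (q - 1)).of_dvd hdvd).trans hx1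
  · have h := Prod.ext_iff.1 hxy
    exact Nat.ModEq.eq_of_lt_of_lt ((Nat.modEq_and_modEq_iff_modEq_mul hcop).1 ⟨h.1, h.2⟩)
      ((hmem x).1 hx).1 ((hmem y).1 hy).1
  · obtain ⟨hr0, hrq⟩ : 0 < r ∧ r < q := hr
    obtain ⟨hαq, hαc, hα1⟩ : α < q - 1 ∧ Nat.gcd α (q - 1) = 1 ∧ α ≡ 1 [MOD δ] := hα
    let x := Nat.chineseRemainder hcop r α
    have hxr : x.1 ≡ r [MOD q] := x.2.1
    have hxα : x.1 ≡ α [MOD q - 1] := x.2.2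
    refine ⟨x.1, (hmem _).2 ⟨?_, ⟨?_, ?_⟩, (hxα.of_dvd hdvd).trans hα1⟩, Prod.ext ?_ ?_⟩
    · exact Nat.chineseRemainder_lt_mul hcop r α hq0.ne' hq1.ne'
    · exact hxr.gcd_eq.trans (Nat.coprime_of_lt_prime hr0.ne' hrq hq).symm
    · exact hxα.gcd_eq.trans hαc
    · exact Eq.trans hxr (Nat.mod_eq_of_lt hrq)
    · exact Eq.trans hxα (Nat.mod_eq_of_lt hαq)

theorem stmt_13 (b q δ : ℕ) (hb : 2 ≤ b) (hq : q.Prime) (hnd : ¬ q ∣ b)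
    (hδ : IsLeast {e : ℕ | 0 < e ∧ b ^ e ≡ 1 [MOD q]} δ) :
    (Zset b q 0).ncard =
      (q - 1) * {α : ℕ | α < q - 1 ∧ Nat.gcd α (q - 1) = 1 ∧ α ≡ 1 [MOD δ]}.ncard := by
  have h := Zset_zero_bijOn hq hnd hδ
  have hIoo : (Set.Ioo 0 q).ncard = q - 1 := by
    rw [← Finset.coe_Ioo, Set.ncard_coe_finset, Nat.card_Ioo, Nat.sub_zero]
  rw [← h.injOn.ncard_image, h.image_eq, Set.ncard_prod, hIoo]
end

section
/- Let b ≥ 2 be a natural number, let q be a prime with q ∤ b, and let k be a natural number with 1 ≤ k ≤ q−1. Let δ denote the multiplicative order of b modulo q and let m_b(q) be the cardinality of 𝒩 = { α ∈ ℕ : 0 ≤ α < q−1, gcd(α, q−1) = 1, α ≡ 1 (mod δ) }. Then the cardinality of Z_k equals φ(q−1) − m_b(q), where φ is Euler's totient function. -/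
/-- If `δ` is the multiplicative order of `b` modulo `q`, then `b ^ m ≡ b ^ n` modulo `q` exactly
when `m ≡ n` modulo `δ`. -/
theorem pow_modEq_pow_iff_of_isLeast {b q δ : ℕ} (hbq : b.Coprime q)
    (hδ : IsLeast {e : ℕ | 0 < e ∧ b ^ e ≡ 1 [MOD q]} δ) (m n : ℕ) :
    b ^ m ≡ b ^ n [MOD q] ↔ m ≡ n [MOD δ] := by
  have hpow : ∀ i j : ℕ, b ^ i ≡ b ^ j [MOD q] ↔
      ZMod.unitOfCoprime b hbq ^ i = ZMod.unitOfCoprime b hbq ^ j := by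
    intro i j
    rw [← ZMod.natCast_eq_natCast_iff, Units.ext_iff]
    simp
  have hord : orderOf (ZMod.unitOfCoprime b hbq) = δ := by
    rw [orderOf_eq_iff hδ.1.1]
    refine ⟨by simpa using (hpow δ 0).1 (by simpa using hδ.1.2), fun e he he0 h => ?_⟩
    have := hδ.2 ⟨he0, by simpa using (hpow e 0).2 (by simpa using h)⟩
    omega
  rw [hpow, pow_eq_pow_iff_modEq, hord]

/-- By Fermat's little theorem, exponents modulo a prime `q` may be reduced modulo `q - 1`. -/
theorem pow_mod_sub_one_modEq {b q : ℕ} (hq : q.Prime) (hbq : b.Coprime q) (x : ℕ) :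
    b ^ (x % (q - 1)) ≡ b ^ x [MOD q] := by
  have h : b ^ (q - 1) ≡ 1 [MOD q] := by
    simpa [Nat.totient_prime hq] using Nat.ModEq.pow_totient hbq
  conv_rhs => rw [← Nat.mod_add_div x (q - 1), pow_add, pow_mul]
  simpa using ((h.pow (x / (q - 1))).mul_left (b ^ (x % (q - 1)))).symm

/-- A linear congruence `c ≡ k * y + b` modulo a prime `q ∤ k` is solvable in `y`. -/
theorem exists_modEq_mul_add {q k : ℕ} (hq : q.Prime) (hk : ¬ q ∣ k) (b c : ℕ) :
    ∃ y, c ≡ k * y + b [MOD q] := by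
  have : Fact q.Prime := ⟨hq⟩
  have hk0 : (k : ZMod q) ≠ 0 := by rwa [Ne, ZMod.natCast_eq_zero_iff]
  refine ⟨(((c : ZMod q) - b) / k).val, ?_⟩
  rw [← ZMod.natCast_eq_natCast_iff]
  push_cast
  rw [ZMod.natCast_zmod_val]
  field_simp
  ring

theorem ncard_Zset_eq_ncard_not_modEq {b q k δ : ℕ} (hq : q.Prime) (hbq : b.Coprime q)
    (hk : ¬ q ∣ k) (hδ : IsLeast {e : ℕ | 0 < e ∧ b ^ e ≡ 1 [MOD q]} δ) :
    (Zset b q k).ncard =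
      {α : ℕ | (α < q - 1 ∧ Nat.gcd α (q - 1) = 1) ∧ ¬ α ≡ 1 [MOD δ]}.ncard := by
  have hq1 : 0 < q - 1 := by have := hq.two_le; omega
  have hcop : q.Coprime (q - 1) := (Nat.coprime_self_sub_right hq.one_le).2 (by simp)
  have hkq : Nat.gcd q k = 1 := (Nat.Prime.coprime_iff_not_dvd hq).2 hk
  have hsol : ∀ {α : ℕ}, α ≡ 1 [MOD δ] ↔ b ^ α ≡ b [MOD q] := by
    intro α
    simpa using (pow_modEq_pow_iff_of_isLeast hbq hδ α 1).symm
  have hdvd : ∀ {c y : ℕ}, c ≡ k * y + b [MOD q] → (c ≡ b [MOD q] ↔ q ∣ y) := by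
    intro c y h
    rw [← hq.dvd_mul.trans (or_iff_right hk), ← Nat.modEq_zero_iff_dvd]
    constructor
    · intro h'
      exact Nat.ModEq.add_right_cancel' b (by simpa using h.symm.trans h')
    · intro h'
      exact h.trans (by simpa using h'.add_right b)
  refine Set.ncard_congr (fun x _ => x % (q - 1)) ?_ ?_ ?_
  · rintro x ⟨-, hx, hxb⟩
    rw [← Nat.Coprime, Nat.coprime_mul_iff_right] at hx
    refine ⟨⟨Nat.mod_lt _ hq1, ?_⟩, ?_⟩
    · rw [← Nat.gcd_rec, Nat.gcd_comm]
      exact hx.2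
    · rw [hsol, hdvd ((pow_mod_sub_one_modEq hq hbq x).trans hxb)]
      exact (Nat.Prime.coprime_iff_not_dvd hq).1 hx.1.symm
  · rintro x y ⟨hx, -, hxb⟩ ⟨hy, -, hyb⟩ hxy
    have hpow : b ^ x ≡ b ^ y [MOD q] := by
      refine (pow_mod_sub_one_modEq hq hbq x).symm.trans ?_
      rw [show x % (q - 1) = y % (q - 1) from hxy]
      exact pow_mod_sub_one_modEq hq hbq y
    have h : x ≡ y [MOD q] := Nat.ModEq.cancel_left_of_coprime hkq
      (Nat.ModEq.add_right_cancel' b (hxb.symm.trans (hpow.trans hyb)))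
    exact ((Nat.modEq_and_modEq_iff_modEq_mul hcop).1 ⟨h, hxy⟩).eq_of_lt_of_lt hx hy
  · rintro α ⟨⟨hα, hαc⟩, hαδ⟩
    obtain ⟨y, hy⟩ := exists_modEq_mul_add hq hk b (b ^ α)
    obtain ⟨x, hxy, hxα⟩ := Nat.chineseRemainder hcop y α
    have hlt : x % (q * (q - 1)) < q * (q - 1) := Nat.mod_lt _ (Nat.mul_pos hq.pos hq1)
    have hmod := Nat.mod_modEq x (q * (q - 1))
    have hzy := (hmod.of_mul_right (q - 1)).trans hxy
    have hzα := (hmod.of_mul_left q).trans hxα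
    generalize x % (q * (q - 1)) = z at hlt hzy hzα
    have hzmod : z % (q - 1) = α := Nat.mod_eq_of_modEq hzα hα
    have hzb : b ^ z ≡ k * z + b [MOD q] := by
      have h := pow_mod_sub_one_modEq hq hbq z
      rw [hzmod] at h
      exact h.symm.trans (hy.trans ((hzy.symm.mul_left k).add_right b))
    refine ⟨z, ⟨hlt, ?_, hzb⟩, hzmod⟩
    rw [← Nat.Coprime, Nat.coprime_mul_iff_right]
    constructor
    · rw [Nat.coprime_comm, Nat.Prime.coprime_iff_not_dvd hq, ← hdvd hzb]
      intro h
      have h' := pow_mod_sub_one_modEq hq hbq z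
      rw [hzmod] at h'
      exact hαδ (hsol.2 (h'.trans h))
    · rw [Nat.Coprime, hzα.gcd_eq, hαc]

theorem ncard_lt_and_gcd_eq_one (n : ℕ) :
    {α : ℕ | α < n ∧ Nat.gcd α n = 1}.ncard = n.totient := by
  rw [Nat.totient_eq_card_coprime, ← Set.ncard_coe_finset]
  congr 1
  ext α
  simp [Nat.coprime_comm, Nat.coprime_iff_gcd_eq_one]

theorem stmt_14 (b q k δ : ℕ) (hb : 2 ≤ b) (hq : q.Prime) (hnd : ¬ q ∣ b)
    (hk1 : 1 ≤ k) (hk2 : k ≤ q - 1)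
    (hδ : IsLeast {e : ℕ | 0 < e ∧ b ^ e ≡ 1 [MOD q]} δ) :
    (Zset b q k).ncard =
      Nat.totient (q - 1) -
        {α : ℕ | α < q - 1 ∧ Nat.gcd α (q - 1) = 1 ∧ α ≡ 1 [MOD δ]}.ncard := by
  have hk : ¬ q ∣ k := Nat.not_dvd_of_pos_of_lt hk1 (by have := hq.two_le; omega)
  have hbq : b.Coprime q := ((Nat.Prime.coprime_iff_not_dvd hq).2 hnd).symm
  have hfin : {α : ℕ | α < q - 1 ∧ Nat.gcd α (q - 1) = 1 ∧ α ≡ 1 [MOD δ]}.Finite :=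
    (Set.finite_lt_nat (q - 1)).subset fun _ h => h.1
  have hsub : {α : ℕ | α < q - 1 ∧ Nat.gcd α (q - 1) = 1 ∧ α ≡ 1 [MOD δ]} ⊆
      {α : ℕ | α < q - 1 ∧ Nat.gcd α (q - 1) = 1} := fun _ h => ⟨h.1, h.2.1⟩
  rw [ncard_Zset_eq_ncard_not_modEq hq hbq hk hδ, ← ncard_lt_and_gcd_eq_one,
    ← Set.ncard_sdiff hsub hfin]
  congr 1
  ext α
  simp only [Set.mem_ofPred_eq, Set.mem_sdiff]
  tauto
end
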